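/- Let a < b be real numbers. Let c ∈ ℝ, g ∈ L^1(a,b), let (x_k) be a sequence of points of (a,b) and (p_k) a sequence of reals with Σ_k |p_k| < ∞, and define the SBV function u(x) := c + ∫_a^x g(t) dt + Σ_k p_k·χ_{[x_k,b]}(x) for x ∈ [a,b]. For s ∈ (0,1) the Riemann–Liouville derivative D_{a+}^s u equals h_s(t) := c (t−a)^{−s}/Γ(1−s) + I_{a+}^{1−s}[g](t) + (1/Γ(1−s)) Σ_k p_k (t−x_k)^{−s} χ_{(x_k,b]}(t) almost everywhere. Then D_{a+}^s u converges weakly-* in the sense of Radon measures on [a,b] to u'·dx + u(a^+)·δ_a + Σ_k p_k·δ_{x_k} as s → 1−; that is, for every continuous function φ : [a,b] → ℝ, ∫_a^b φ(x) h_s(x) dx → ∫_a^b φ(x) g(x) dx + c·φ(a) + Σ_k p_k φ(x_k) as s → 1−. -/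

import Mathlib

open MeasureTheory Set Filter ENNReal

/-- The left Riemann–Liouville fractional integral of order `σ` with base point `a`. -/
noncomputable def RLint (a σ : ℝ) (u : ℝ → ℝ) (x : ℝ) : ℝ :=
  (Real.Gamma σ)⁻¹ * ∫ t in a..x, u t * (x - t) ^ (σ - 1)

/-- truncated power kernel -/
noncomputable def kk (s r : ℝ) : ℝ := if 0 < r then r ^ (-s) else 0

/-- its primitive -/
noncomputable def k1 (s r : ℝ) : ℝ := if 0 < r then r ^ (1 - s) / (1 - s) else 0

lemma kk_nonneg (s r : ℝ) : 0 ≤ kk s r := by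
  unfold kk
  split_ifs with h
  · exact Real.rpow_nonneg h.le _
  · exact le_rfl

lemma k1_nonneg {s : ℝ} (hs : s < 1) (r : ℝ) : 0 ≤ k1 s r := by
  unfold k1
  split_ifs with h
  · exact div_nonneg (Real.rpow_nonneg h.le _) (by linarith)
  · exact le_rfl

lemma measurable_kk (s : ℝ) : Measurable (kk s) := by
  unfold kk
  exact Measurable.ite measurableSet_Ioi (by fun_prop) measurable_const

lemma kk_intervalIntegrable {s : ℝ} (hs : s < 1) (α β : ℝ) :
    IntervalIntegrable (kk s) volume α β := by
  have h := intervalIntegral.intervalIntegrable_rpow' (a := α) (b := β) (r := -s) (by linarith)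
  refine h.mono_fun (measurable_kk s).aestronglyMeasurable ?_
  filter_upwards with x
  unfold kk
  split_ifs with h
  · exact le_rfl
  · simp

lemma kk_sub_intervalIntegrable {s : ℝ} (hs : s < 1) (y α β : ℝ) :
    IntervalIntegrable (fun t => kk s (t - y)) volume α β := by
  have := (kk_intervalIntegrable hs (α - y) (β - y)).comp_sub_right y
  simpa using this

lemma kk_sub'_intervalIntegrable {s : ℝ} (hs : s < 1) (y α β : ℝ) :
    IntervalIntegrable (fun t => kk s (y - t)) volume α β := by
  have := (kk_intervalIntegrable hs (y - α) (y - β)).comp_sub_left y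
  simpa using this

lemma integral_kk_zero {s : ℝ} (hs : s < 1) {r : ℝ} (hr : 0 ≤ r) :
    ∫ t in (0:ℝ)..r, kk s t = k1 s r := by
  have h1 : ∫ t in (0:ℝ)..r, kk s t = ∫ t in (0:ℝ)..r, t ^ (-s) := by
    rw [intervalIntegral.integral_of_le hr, intervalIntegral.integral_of_le hr]
    refine setIntegral_congr_fun measurableSet_Ioc fun t ht => ?_
    simp [kk, ht.1]
  rw [h1, integral_rpow (Or.inl (by linarith))]
  have e : -s + 1 = 1 - s := by ring
  have hne : 1 - s ≠ 0 := by linarith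
  rw [e, Real.zero_rpow hne, sub_zero]
  unfold k1
  split_ifs with h
  · rfl
  · have : r = 0 := by linarith
    rw [this, Real.zero_rpow hne]; simp

lemma integral_kk_neg {s : ℝ} {α r : ℝ} (hα : α ≤ r) (hr : r ≤ 0) :
    ∫ t in α..r, kk s t = 0 := by
  rw [intervalIntegral.integral_of_le hα]
  have : ∀ t ∈ Ioc α r, kk s t = (fun _ => (0:ℝ)) t := by
    intro t ht
    simp only [kk]; rw [if_neg]; linarith [ht.2]
  rw [setIntegral_congr_fun measurableSet_Ioc this]; simp

lemma integral_kk_sub {s : ℝ} (hs : s < 1) {a x y : ℝ} (hay : a ≤ y) (hax : a ≤ x) :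
    ∫ t in a..x, kk s (t - y) = k1 s (x - y) := by
  rw [intervalIntegral.integral_comp_sub_right (fun t => kk s t)]
  rcases le_total x y with h | h
  · rw [integral_kk_neg (by linarith) (by linarith)]
    simp [k1, h]
  · rw [← intervalIntegral.integral_add_adjacent_intervals (b := 0)
      (kk_intervalIntegrable hs _ _) (kk_intervalIntegrable hs _ _),
      integral_kk_neg (by linarith) le_rfl, integral_kk_zero hs (by linarith), zero_add]

lemma integral_ind_kk {s : ℝ} (hs : s < 1) {a x y : ℝ} (hay : a ≤ y) (hax : a ≤ x) :
    ∫ t in a..x, (if y ≤ t then 1 else 0) * kk s (x - t) = k1 s (x - y) := by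
  have e : ∀ t, (if y ≤ t then (1:ℝ) else 0) * kk s (x - t)
      = (fun r => (if r ≤ x - y then (1:ℝ) else 0) * kk s r) (x - t) := by
    intro t
    have : y ≤ t ↔ x - t ≤ x - y := by constructor <;> intro h <;> linarith
    simp only [this]
  simp_rw [e]
  rw [intervalIntegral.integral_comp_sub_left
    (fun r => (if r ≤ x - y then (1:ℝ) else 0) * kk s r), sub_self,
    intervalIntegral.integral_of_le (by linarith)]
  have e2 : ∀ r, (if r ≤ x - y then (1:ℝ) else 0) * kk s r
      = (Iic (x - y)).indicator (kk s) r := by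
    intro r; simp [indicator]
  simp_rw [e2]
  rw [setIntegral_indicator measurableSet_Iic]
  have e3 : Ioc 0 (x - a) ∩ Iic (x - y) = Ioc 0 (x - y) := by
    ext r; simp only [mem_inter_iff, mem_Ioc, mem_Iic]
    constructor
    · rintro ⟨⟨h1, h2⟩, h3⟩; exact ⟨h1, h3⟩
    · rintro ⟨h1, h2⟩; exact ⟨⟨h1, by linarith⟩, h2⟩
  rw [e3]
  rcases le_total x y with h | h
  · rw [Ioc_eq_empty (by linarith)]; simp [k1, h]
  · rw [← intervalIntegral.integral_of_le (by linarith), integral_kk_zero hs (by linarith)]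

lemma k1_le {s : ℝ} (hs : s < 1) {r R : ℝ} (h : r ≤ R) : k1 s r ≤ k1 s R := by
  unfold k1
  split_ifs with h1 h2 h2
  · have : 0 < 1 - s := by linarith
    gcongr
  · linarith
  · exact div_nonneg (Real.rpow_nonneg h2.le _) (by linarith)
  · exact le_rfl

lemma measurable_k1 (s : ℝ) : Measurable (k1 s) := by
  unfold k1
  exact Measurable.ite measurableSet_Ioi (by fun_prop) measurable_const

set_option linter.unusedSectionVars false

section general
variable {T : Type*} [MeasurableSpace T] {ν : Measure T} [SFinite ν] {w y : T → ℝ}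

lemma prod_integrable {s : ℝ} (hs : s < 1) {a x : ℝ} (hax : a ≤ x)
    (hw : Integrable w ν) (hy : Measurable y) (hya : ∀ τ, a ≤ y τ) :
    Integrable (fun z : T × ℝ => w z.1 * kk s (z.2 - y z.1))
      (ν.prod (volume.restrict (Ioc a x))) := by
  have hm : AEStronglyMeasurable (fun z : T × ℝ => w z.1 * kk s (z.2 - y z.1))
      (ν.prod (volume.restrict (Ioc a x))) := by
    refine hw.1.comp_fst.mul ?_
    exact ((measurable_kk s).comp (by fun_prop)).aestronglyMeasurable
  rw [integrable_prod_iff hm]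
  constructor
  · filter_upwards with τ
    exact ((kk_sub_intervalIntegrable hs (y τ) a x).1).const_mul (w τ)
  · have e : ∀ τ, ∫ t in Ioc a x, ‖w τ * kk s (t - y τ)‖ = k1 s (x - y τ) * ‖w τ‖ := by
      intro τ
      have : ∀ t, ‖w τ * kk s (t - y τ)‖ = ‖w τ‖ * kk s (t - y τ) := by
        intro t; rw [norm_mul, Real.norm_of_nonneg (kk_nonneg _ _)]
      simp_rw [this]
      rw [integral_const_mul, ← intervalIntegral.integral_of_le hax,
        integral_kk_sub hs (hya τ) hax, mul_comm]
    simp only [e]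
    refine Integrable.bdd_mul (c := k1 s (x - a)) hw.norm ?_ ?_
    · exact ((measurable_k1 s).comp (by fun_prop)).aestronglyMeasurable
    · filter_upwards with τ
      rw [Real.norm_of_nonneg (k1_nonneg hs _)]
      exact k1_le hs (by linarith [hya τ])

lemma prod_integrable' {s : ℝ} (hs : s < 1) {a x : ℝ}
    (hw : Integrable w ν) (hy : Measurable y) :
    Integrable (fun z : T × ℝ => w z.1 * ((if y z.1 ≤ z.2 then 1 else 0) * kk s (x - z.2)))
      (ν.prod (volume.restrict (Ioc a x))) := by
  have h1 : Integrable (fun z : T × ℝ => w z.1 * kk s (x - z.2))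
      (ν.prod (volume.restrict (Ioc a x))) :=
    hw.mul_prod (kk_sub'_intervalIntegrable hs x a x).1
  refine h1.mono ?_ ?_
  · refine hw.1.comp_fst.mul ?_
    refine Measurable.aestronglyMeasurable (Measurable.mul ?_ ((measurable_kk s).comp (by fun_prop)))
    exact Measurable.ite (measurableSet_le (by fun_prop) (by fun_prop)) measurable_const
      measurable_const
  · filter_upwards with z
    split_ifs <;> simp
    positivity

/-- Fubini identity. -/
lemma fubini_piece {s : ℝ} (hs : s < 1) {a x : ℝ} (hax : a ≤ x)
    (hw : Integrable w ν) (hy : Measurable y) (hya : ∀ τ, a ≤ y τ) :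
    ∫ t in a..x, (∫ τ, w τ * (if y τ ≤ t then 1 else 0) ∂ν) * kk s (x - t)
      = ∫ t in a..x, ∫ τ, w τ * kk s (t - y τ) ∂ν := by
  have h1 := integral_integral_swap (f := fun τ t => w τ * kk s (t - y τ))
    (prod_integrable hs hax hw hy hya)
  have h2 := integral_integral_swap
    (f := fun τ t => w τ * ((if y τ ≤ t then 1 else 0) * kk s (x - t)))
    (prod_integrable' (a := a) (x := x) hs hw hy)
  rw [intervalIntegral.integral_of_le hax, intervalIntegral.integral_of_le hax, ← h1]
  simp_rw [← integral_mul_const, mul_assoc]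
  rw [← h2]
  congr 1
  ext τ
  rw [integral_const_mul, integral_const_mul, ← intervalIntegral.integral_of_le hax,
    ← intervalIntegral.integral_of_le hax, integral_kk_sub hs (hya τ) hax,
    integral_ind_kk hs (hya τ) hax]

lemma integrable_U {s : ℝ} (hs : s < 1) {a x : ℝ} (hax : a ≤ x)
    (hw : Integrable w ν) (hy : Measurable y) :
    IntervalIntegrable (fun t => (∫ τ, w τ * (if y τ ≤ t then 1 else 0) ∂ν) * kk s (x - t))
      volume a x := by
  have := (prod_integrable' (a := a) (x := x) hs hw hy).integral_prod_right
  rw [intervalIntegrable_iff_integrableOn_Ioc_of_le hax]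
  simp_rw [← integral_mul_const, mul_assoc]
  exact this

lemma deriv_piece {s : ℝ} (hs : s < 1) {a b : ℝ} (hab : a < b)
    (hw : Integrable w ν) (hy : Measurable y) (hya : ∀ τ, a ≤ y τ) :
    ∀ᵐ x ∂(volume.restrict (Ioo a b)), HasDerivAt (fun x =>
      ∫ t in a..x, (∫ τ, w τ * (if y τ ≤ t then 1 else 0) ∂ν) * kk s (x - t))
      (∫ τ, w τ * kk s (x - y τ) ∂ν) x := by
  have hI : IntervalIntegrable (fun t => ∫ τ, w τ * kk s (t - y τ) ∂ν) volume a b := by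
    rw [intervalIntegrable_iff_integrableOn_Ioc_of_le hab.le]
    exact (prod_integrable hs hab.le hw hy hya).integral_prod_right
  rw [ae_restrict_iff' measurableSet_Ioo]
  filter_upwards [hI.ae_hasDerivAt_integral] with x hx hxm
  rw [uIcc_of_le hab.le] at hx
  refine (hx (Ioo_subset_Icc_self hxm) a (left_mem_Icc.2 hab.le)).congr_of_eventuallyEq ?_
  filter_upwards [Ioi_mem_nhds hxm.1] with z hz
  exact fubini_piece hs (le_of_lt hz) hw hy hya


lemma gamma_inv_eq {s : ℝ} (hs : s < 1) :
    (Real.Gamma (1 - s))⁻¹ = (1 - s) * (Real.Gamma (2 - s))⁻¹ := by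
  have h : Real.Gamma (2 - s) = (1 - s) * Real.Gamma (1 - s) := by
    rw [← Real.Gamma_add_one (by linarith)]; congr 1; ring
  have h1 : 1 - s ≠ 0 := by linarith
  have h2 := (Real.Gamma_pos_of_pos (s := 1 - s) (by linarith)).ne'
  rw [h]; field_simp

lemma tendsto_gamma2 :
    Tendsto (fun s : ℝ => (Real.Gamma (2 - s))⁻¹) (nhdsWithin 1 (Iio 1)) (nhds 1) := by
  have h : ContinuousAt (fun s : ℝ => (Real.Gamma (2 - s))⁻¹) 1 := by
    have h0 : ContinuousAt Real.Gamma (2 - 1) := by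
      refine (Real.differentiableAt_Gamma fun m => ?_).continuousAt
      have : (0:ℝ) ≤ m := Nat.cast_nonneg m
      linarith
    have h1 : ContinuousAt (fun s : ℝ => Real.Gamma (2 - s)) 1 :=
      ContinuousAt.comp (f := fun s : ℝ => 2 - s) (g := Real.Gamma) h0 (by fun_prop)
    refine h1.inv₀ ?_
    exact (Real.Gamma_pos_of_pos (by norm_num)).ne'
  have h2 := h.tendsto
  have e : (Real.Gamma (2 - 1))⁻¹ = 1 := by norm_num [Real.Gamma_one]
  rw [e] at h2
  exact h2.mono_left nhdsWithin_le_nhds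

lemma tendsto_gamma_inv :
    Tendsto (fun s : ℝ => (Real.Gamma (1 - s))⁻¹) (nhdsWithin 1 (Iio 1)) (nhds 0) := by
  have h1 : Tendsto (fun s : ℝ => 1 - s) (nhdsWithin 1 (Iio 1)) (nhds (1 - 1)) :=
    ((continuous_const.sub continuous_id).tendsto (1:ℝ)).mono_left nhdsWithin_le_nhds
  have h := h1.mul tendsto_gamma2
  rw [sub_self, zero_mul] at h
  refine h.congr' ?_
  filter_upwards [self_mem_nhdsWithin] with s hs
  exact (gamma_inv_eq hs).symm

lemma tendsto_rpow_aux {r : ℝ} (hr : 0 < r) :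
    Tendsto (fun s : ℝ => r ^ (1 - s)) (nhdsWithin 1 (Iio 1)) (nhds 1) := by
  have : Continuous (fun s : ℝ => r ^ (1 - s)) :=
    Continuous.rpow continuous_const (by fun_prop) (fun _ => Or.inl hr.ne')
  have h := this.tendsto 1
  simp only [sub_self, Real.rpow_zero] at h
  exact h.mono_left nhdsWithin_le_nhds

lemma tendsto_mass {r : ℝ} (hr : 0 < r) :
    Tendsto (fun s : ℝ => (Real.Gamma (1 - s))⁻¹ * k1 s r) (nhdsWithin 1 (Iio 1)) (nhds 1) := by
  have h := (tendsto_rpow_aux hr).mul tendsto_gamma2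
  rw [one_mul] at h
  refine h.congr' ?_
  filter_upwards [self_mem_nhdsWithin] with s hs
  have hs' : s < 1 := hs
  have h1 : 1 - s ≠ 0 := by linarith
  rw [gamma_inv_eq hs', k1, if_pos hr]
  field_simp

lemma ioo_mem : ∀ᶠ s : ℝ in nhdsWithin 1 (Iio 1), s ∈ Ioo (0:ℝ) 1 :=
  Ioo_mem_nhdsLT (by norm_num)

lemma peak {a b y : ℝ} (hay : a ≤ y) (hyb : y < b) {φ : ℝ → ℝ} (hφ : ContinuousOn φ (Icc a b)) :
    Tendsto (fun s : ℝ => ∫ x in Ioc a b, ((Real.Gamma (1 - s))⁻¹ * kk s (x - y)) * φ x)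
      (nhdsWithin 1 (Iio 1)) (nhds (φ y)) := by
  have e : ∀ s : ℝ, ∫ x in Ioc a b, ((Real.Gamma (1 - s))⁻¹ * kk s (x - y)) * φ x
      = ∫ x in Ioc y b, ((Real.Gamma (1 - s))⁻¹ * kk s (x - y)) • φ x := by
    intro s
    simp only [smul_eq_mul]
    refine setIntegral_eq_of_subset_of_forall_sdiff_eq_zero measurableSet_Ioc
      (Ioc_subset_Ioc_left hay) ?_
    rintro x ⟨h1, h2⟩
    have : ¬ y < x := fun h => h2 ⟨h, h1.2⟩
    simp [kk, this]
  simp_rw [e]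
  refine tendsto_setIntegral_peak_smul_of_integrableOn_of_tendsto
    (μ := volume) (s := Ioc y b) (x₀ := y) (φ := fun (s : ℝ) x => (Real.Gamma (1 - s))⁻¹ * kk s (x - y)) (g := φ) (a := φ y)
    (l := nhdsWithin 1 (Iio 1)) measurableSet_Ioc (t := Ioc y b)
    measurableSet_Ioc subset_rfl self_mem_nhdsWithin (by simp) ?_ ?_ ?_ ?_ ?_ ?_
  · filter_upwards [ioo_mem] with s hs x hx
    exact mul_nonneg (inv_nonneg.2 (Real.Gamma_pos_of_pos (by linarith [hs.2])).le) (kk_nonneg _ _)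
  · intro u hu hyu
    obtain ⟨ε, hε, hb⟩ := Metric.isOpen_iff.1 hu y hyu
    rw [Metric.tendstoUniformlyOn_iff]
    intro η hη
    have hc : Continuous (fun s : ℝ => ε ^ (-s)) :=
      Continuous.rpow continuous_const (by fun_prop) (fun _ => Or.inl hε.ne')
    have ht := tendsto_gamma_inv.mul ((hc.tendsto 1).mono_left
      (nhdsWithin_le_nhds (s := Iio 1)))
    rw [zero_mul] at ht
    filter_upwards [ioo_mem, ht.eventually (gt_mem_nhds hη)] with s hs hlt x hx
    have hG : 0 ≤ (Real.Gamma (1 - s))⁻¹ :=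
      inv_nonneg.2 (Real.Gamma_pos_of_pos (by linarith [hs.2])).le
    have hx1 : y < x := hx.1.1
    have hx2 : ε ≤ x - y := by
      by_contra hcon
      push Not at hcon
      exact hx.2 (hb (by rw [Metric.mem_ball, Real.dist_eq, abs_of_pos] <;> linarith))
    simp only [Pi.zero_apply, dist_zero_left]
    rw [Real.norm_of_nonneg (mul_nonneg hG (kk_nonneg _ _))]
    refine lt_of_le_of_lt (mul_le_mul_of_nonneg_left ?_ hG) hlt
    rw [kk, if_pos (by linarith)]
    exact Real.rpow_le_rpow_of_nonpos hε hx2 (by linarith [hs.1])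
  · refine (tendsto_mass (r := b - y) (by linarith)).congr' ?_
    filter_upwards [ioo_mem] with s hs
    rw [integral_const_mul, ← intervalIntegral.integral_of_le hyb.le,
      integral_kk_sub hs.2 le_rfl hyb.le]
  · filter_upwards with s
    exact (measurable_const.mul ((measurable_kk s).comp (by fun_prop))).aestronglyMeasurable
  · exact (hφ.integrableOn_Icc).mono_set
      (Ioc_subset_Icc_self.trans (Icc_subset_Icc_left hay))
  · exact (hφ y ⟨hay, hyb.le⟩).mono_left
      (nhdsWithin_mono _ (Ioc_subset_Icc_self.trans (Icc_subset_Icc_left hay)))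

lemma prod_integrable_phi {s : ℝ} (hs : s < 1) {a b : ℝ} (hab : a ≤ b)
    (hw : Integrable w ν) (hy : Measurable y) (hya : ∀ τ, a ≤ y τ)
    {φ : ℝ → ℝ} (hφ : ContinuousOn φ (Icc a b)) :
    Integrable (fun z : T × ℝ => φ z.2 * ((Real.Gamma (1 - s))⁻¹ * (w z.1 * kk s (z.2 - y z.1))))
      (ν.prod (volume.restrict (Ioc a b))) := by
  obtain ⟨M, hM⟩ := isCompact_Icc.exists_bound_of_continuousOn hφ
  refine Integrable.bdd_mul (c := M) ((prod_integrable hs hab hw hy hya).const_mul _) ?_ ?_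
  · exact (((hφ.mono Ioc_subset_Icc_self).aestronglyMeasurable measurableSet_Ioc)).comp_snd
  · have h1 : ∀ᵐ x ∂(volume.restrict (Ioc a b)), ‖φ x‖ ≤ M := by
      filter_upwards [ae_restrict_mem measurableSet_Ioc] with x hx
      exact hM x (Ioc_subset_Icc_self hx)
    exact Measure.quasiMeasurePreserving_snd.ae h1

lemma weak_integrable {s : ℝ} (hs : s < 1) {a b : ℝ} (hab : a ≤ b)
    (hw : Integrable w ν) (hy : Measurable y) (hya : ∀ τ, a ≤ y τ)
    {φ : ℝ → ℝ} (hφ : ContinuousOn φ (Icc a b)) :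
    IntegrableOn (fun x => φ x * ((Real.Gamma (1 - s))⁻¹ * ∫ τ, w τ * kk s (x - y τ) ∂ν))
      (Ioc a b) := by
  have := (prod_integrable_phi hs hab hw hy hya hφ).integral_prod_right
  simp_rw [integral_const_mul] at this
  exact this

lemma weak_piece {a b : ℝ} (hab : a ≤ b)
    (hw : Integrable w ν) (hy : Measurable y) (hya : ∀ τ, a ≤ y τ)
    (hyb : ∀ᵐ τ ∂ν, y τ < b)
    {φ : ℝ → ℝ} (hφ : ContinuousOn φ (Icc a b)) :
    Tendsto (fun s : ℝ => ∫ x in Ioc a b,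
        φ x * ((Real.Gamma (1 - s))⁻¹ * ∫ τ, w τ * kk s (x - y τ) ∂ν))
      (nhdsWithin 1 (Iio 1)) (nhds (∫ τ, w τ * φ (y τ) ∂ν)) := by
  obtain ⟨M, hM⟩ := isCompact_Icc.exists_bound_of_continuousOn hφ
  have hM0 : 0 ≤ M := (norm_nonneg _).trans (hM a (left_mem_Icc.2 hab))
  have key : ∀ s : ℝ, s < 1 → (∫ x in Ioc a b,
        φ x * ((Real.Gamma (1 - s))⁻¹ * ∫ τ, w τ * kk s (x - y τ) ∂ν))
      = ∫ τ, w τ * (∫ x in Ioc a b, ((Real.Gamma (1 - s))⁻¹ * kk s (x - y τ)) * φ x) ∂ν := by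
    intro s hs
    have := integral_integral_swap
      (f := fun τ x => φ x * ((Real.Gamma (1 - s))⁻¹ * (w τ * kk s (x - y τ))))
      (prod_integrable_phi hs hab hw hy hya hφ)
    simp_rw [integral_const_mul] at this
    rw [← this]
    congr 1
    ext τ
    rw [← integral_const_mul]
    congr 1
    ext x
    ring
  have hmass : ∀ᶠ s : ℝ in nhdsWithin 1 (Iio 1),
      (Real.Gamma (1 - s))⁻¹ * k1 s (b - a + 1) < 2 :=
    (tendsto_mass (r := b - a + 1) (by linarith)).eventually (gt_mem_nhds (by norm_num))
  have hD : Tendsto (fun s : ℝ =>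
      ∫ τ, w τ * (∫ x in Ioc a b, ((Real.Gamma (1 - s))⁻¹ * kk s (x - y τ)) * φ x) ∂ν)
      (nhdsWithin 1 (Iio 1)) (nhds (∫ τ, w τ * φ (y τ) ∂ν)) := by
    refine tendsto_integral_filter_of_dominated_convergence (fun τ => ‖w τ‖ * (2 * M)) ?_ ?_ ?_ ?_
    · filter_upwards [ioo_mem] with s hs
      have := (prod_integrable_phi hs.2 hab hw hy hya hφ).integral_prod_left.1
      refine this.congr ?_
      filter_upwards with τ
      rw [← integral_const_mul]
      congr 1
      ext x
      ring
    · filter_upwards [ioo_mem, hmass] with s hs hms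
      have hG : 0 ≤ (Real.Gamma (1 - s))⁻¹ :=
        inv_nonneg.2 (Real.Gamma_pos_of_pos (by linarith [hs.2])).le
      filter_upwards with τ
      rw [norm_mul]
      refine mul_le_mul_of_nonneg_left ?_ (norm_nonneg _)
      have h1 : ‖∫ x in Ioc a b, ((Real.Gamma (1 - s))⁻¹ * kk s (x - y τ)) * φ x‖
          ≤ ∫ x in Ioc a b, (Real.Gamma (1 - s))⁻¹ * M * kk s (x - y τ) := by
        refine norm_integral_le_of_norm_le
          (((kk_sub_intervalIntegrable hs.2 (y τ) a b).1).const_mul _) ?_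
        filter_upwards [ae_restrict_mem measurableSet_Ioc] with x hx
        rw [norm_mul, Real.norm_of_nonneg (mul_nonneg hG (kk_nonneg _ _))]
        calc _ ≤ (Real.Gamma (1 - s))⁻¹ * kk s (x - y τ) * M :=
              mul_le_mul_of_nonneg_left (hM x (Ioc_subset_Icc_self hx))
                (mul_nonneg hG (kk_nonneg _ _))
          _ = _ := by ring
      refine h1.trans ?_
      rw [integral_const_mul, ← intervalIntegral.integral_of_le hab,
        integral_kk_sub hs.2 (hya τ) hab]
      have h2 : k1 s (b - y τ) ≤ k1 s (b - a + 1) := k1_le hs.2 (by linarith [hya τ])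
      calc _ = ((Real.Gamma (1 - s))⁻¹ * k1 s (b - y τ)) * M := by ring
        _ ≤ ((Real.Gamma (1 - s))⁻¹ * k1 s (b - a + 1)) * M := by gcongr
        _ ≤ 2 * M := by gcongr
    · exact hw.norm.mul_const _
    · filter_upwards [hyb] with τ hτ
      exact (peak (hya τ) hτ hφ).const_mul _
  refine hD.congr' ?_
  filter_upwards [ioo_mem] with s hs
  exact (key s hs.2).symm

end general

lemma integral_nat_count (f : ℕ → ℝ) : ∫ k, f k ∂Measure.count = ∑' k, f k := by
  by_cases h : Integrable f Measure.count
  · rw [integral_countable h]; simp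
  · rw [integral_undef h, tsum_eq_zero_of_not_summable]
    rw [integrable_count_iff] at h
    exact fun hs => h (by simpa using hs.norm)

lemma H2_eq {a b : ℝ} (g : ℝ → ℝ) {s x : ℝ} (hx : x ∈ Ioo a b) :
    (Real.Gamma (1 - s))⁻¹ * ∫ τ in Ioo a b, g τ * kk s (x - max a τ)
      = RLint a (1 - s) g x := by
  unfold RLint
  congr 1
  rw [intervalIntegral.integral_of_le hx.1.le, integral_Ioc_eq_integral_Ioo]
  rw [setIntegral_eq_of_subset_of_forall_sdiff_eq_zero measurableSet_Ioo
    (Ioo_subset_Ioo_right hx.2.le)]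
  · refine setIntegral_congr_fun measurableSet_Ioo fun τ hτ => ?_
    have e : (1 - s - 1) = -s := by ring
    have : τ < x := hτ.2
    simp only [max_eq_right hτ.1.le, kk, sub_pos, this, if_true, e]
  · rintro τ ⟨h1, h2⟩
    have : ¬ τ < x := fun h => h2 ⟨h1.1, h⟩
    simp [max_eq_right h1.1.le, kk, this]

lemma U2_eq {a b : ℝ} (g : ℝ → ℝ) {t : ℝ} (ht : t ∈ Ioo a b) :
    ∫ τ in Ioo a b, g τ * (if max a τ ≤ t then 1 else 0) = ∫ τ in a..t, g τ := by
  rw [intervalIntegral.integral_of_le ht.1.le]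
  rw [setIntegral_eq_of_subset_of_forall_sdiff_eq_zero measurableSet_Ioo
    (s := Ioc a t) (fun τ h => ⟨h.1, lt_of_le_of_lt h.2 ht.2⟩)]
  · refine setIntegral_congr_fun measurableSet_Ioc fun τ hτ => ?_
    simp [hτ.2, ht.1.le]
  · rintro τ ⟨h1, h2⟩
    have : ¬ τ ≤ t := fun h => h2 ⟨h1.1, h⟩
    simp [this]

lemma H3_eq {b : ℝ} (p xk : ℕ → ℝ) {s x : ℝ} (hx : x ≤ b) :
    ∫ k, p k * kk s (x - xk k) ∂Measure.count
      = ∑' k, Set.indicator (Set.Ioc (xk k) b) (fun y => p k * (y - xk k) ^ (-s)) x := by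
  rw [integral_nat_count]
  congr 1
  ext k
  simp [indicator, kk, hx]

lemma U3_eq {b : ℝ} (p xk : ℕ → ℝ) {x : ℝ} (hx : x ≤ b) :
    ∫ k, p k * (if xk k ≤ x then 1 else 0) ∂Measure.count
      = ∑' k, Set.indicator (Set.Icc (xk k) b) (fun _ => p k) x := by
  rw [integral_nat_count]
  congr 1
  ext k
  simp [indicator, hx]

/-- for an SBV function `u(x) = c + ∫_a^x g + Σ_k p_k χ_{[x_k,b]}(x)`, the
fractional derivative `h_s = D_{a+}^s u` converges weakly-* (as Radon measures on `[a,b]`)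
to `u'·dx + u(a⁺)·δ_a + Σ_k p_k δ_{x_k}` as `s → 1-`. -/
theorem sbv_rl_deriv_weak_star (a b : ℝ) (hab : a < b)
    (c : ℝ) (g : ℝ → ℝ) (hg : IntegrableOn g (Set.Ioo a b))
    (xk : ℕ → ℝ) (hxk : ∀ k, xk k ∈ Set.Ioo a b)
    (p : ℕ → ℝ) (hp : Summable fun k => |p k|) :
    (∀ s ∈ Set.Ioo (0:ℝ) 1, ∀ᵐ x ∂(volume.restrict (Set.Ioo a b)),
      HasDerivAt
        (RLint a (1 - s)
          (fun y => c + (∫ t in a..y, g t) +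
            ∑' k, Set.indicator (Set.Icc (xk k) b) (fun _ => p k) y))
        (c * (x - a) ^ (-s) / Real.Gamma (1 - s) + RLint a (1 - s) g x +
          (Real.Gamma (1 - s))⁻¹ *
            ∑' k, Set.indicator (Set.Ioc (xk k) b) (fun y => p k * (y - xk k) ^ (-s)) x)
        x) ∧
    (∀ φ : ℝ → ℝ, ContinuousOn φ (Set.Icc a b) →
      Filter.Tendsto
        (fun s : ℝ => ∫ x in Set.Ioo a b,
          φ x * (c * (x - a) ^ (-s) / Real.Gamma (1 - s) + RLint a (1 - s) g x +
            (Real.Gamma (1 - s))⁻¹ *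
              ∑' k, Set.indicator (Set.Ioc (xk k) b) (fun y => p k * (y - xk k) ^ (-s)) x))
        (nhdsWithin 1 (Set.Iio 1))
        (nhds ((∫ x in Set.Ioo a b, φ x * g x) + c * φ a + ∑' k, p k * φ (xk k)))) := by

  have hw1 : Integrable (fun _ : Unit => c) (Measure.dirac ()) := integrable_const c
  have hw3 : Integrable p Measure.count := by
    rw [integrable_count_iff]; simpa using hp
  have hy1 : Measurable (fun _ : Unit => a) := measurable_const
  have hy2 : Measurable (fun τ : ℝ => max a τ) := measurable_const.max measurable_id
  have hy3 : Measurable xk := measurable_from_nat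
  have ha1 : ∀ τ : Unit, a ≤ (fun _ : Unit => a) τ := fun _ => le_rfl
  have ha2 : ∀ τ : ℝ, a ≤ (fun τ : ℝ => max a τ) τ := fun τ => le_max_left _ _
  have ha3 : ∀ k, a ≤ xk k := fun k => (hxk k).1.le
  -- the formula for `h_s` in terms of the three pieces
  have hH : ∀ s x : ℝ, x ∈ Ioo a b →
      c * (x - a) ^ (-s) / Real.Gamma (1 - s) + RLint a (1 - s) g x +
          (Real.Gamma (1 - s))⁻¹ *
            ∑' k, Set.indicator (Set.Ioc (xk k) b) (fun y => p k * (y - xk k) ^ (-s)) x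
      = (Real.Gamma (1 - s))⁻¹ * (∫ _ : Unit, c * kk s (x - a) ∂(Measure.dirac ()))
        + (Real.Gamma (1 - s))⁻¹ * (∫ τ in Ioo a b, g τ * kk s (x - max a τ))
        + (Real.Gamma (1 - s))⁻¹ * (∫ k, p k * kk s (x - xk k) ∂Measure.count) := by
    intro s x hx
    rw [H2_eq g hx, H3_eq p xk hx.2.le, integral_dirac, kk, if_pos (sub_pos.2 hx.1)]
    ring
  constructor
  · intro s hs
    filter_upwards [deriv_piece hs.2 hab hw1 hy1 ha1, deriv_piece hs.2 hab hg hy2 ha2,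
      deriv_piece hs.2 hab hw3 hy3 ha3, ae_restrict_mem measurableSet_Ioo] with x h1 h2 h3 hx
    rw [hH s x hx]
    refine HasDerivAt.congr_of_eventuallyEq (((h1.const_mul (Real.Gamma (1 - s))⁻¹).add
      (h2.const_mul (Real.Gamma (1 - s))⁻¹)).add (h3.const_mul (Real.Gamma (1 - s))⁻¹)) ?_
    filter_upwards [Ioo_mem_nhds hx.1 hx.2] with z hz
    have i1 := integrable_U hs.2 hz.1.le hw1 hy1
    have i2 := integrable_U hs.2 hz.1.le hg hy2
    have i3 := integrable_U hs.2 hz.1.le hw3 hy3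
    simp only [Pi.add_apply]
    rw [← mul_add, ← mul_add, ← intervalIntegral.integral_add i1 i2,
      ← intervalIntegral.integral_add (i1.add i2) i3]
    unfold RLint
    congr 1
    rw [intervalIntegral.integral_of_le hz.1.le, intervalIntegral.integral_of_le hz.1.le,
      integral_Ioc_eq_integral_Ioo, integral_Ioc_eq_integral_Ioo]
    refine setIntegral_congr_fun measurableSet_Ioo fun t ht => ?_
    have htb : t < b := ht.2.trans hz.2
    have e : (1 - s - 1) = -s := by ring
    simp only [Pi.add_apply]
    rw [U2_eq g ⟨ht.1, htb⟩, U3_eq p xk htb.le, integral_dirac, if_pos ht.1.le, kk,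
      if_pos (sub_pos.2 ht.2), e]
    ring
  · intro φ hφ
    have hb2 : ∀ᵐ τ ∂(volume.restrict (Ioo a b)), (fun τ : ℝ => max a τ) τ < b := by
      filter_upwards [ae_restrict_mem measurableSet_Ioo] with τ hτ
      exact max_lt hab hτ.2
    have t1 := weak_piece hab.le hw1 hy1 ha1 (Eventually.of_forall fun _ => hab) hφ
    have t2 := weak_piece hab.le hg hy2 ha2 hb2 hφ
    have t3 := weak_piece hab.le hw3 hy3 ha3 (Eventually.of_forall fun k => (hxk k).2) hφ
    have l1 : ∫ _ : Unit, c * φ a ∂(Measure.dirac ()) = c * φ a := by rw [integral_dirac]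
    have l2 : ∫ τ in Ioo a b, g τ * φ (max a τ) = ∫ x in Ioo a b, φ x * g x := by
      refine setIntegral_congr_fun measurableSet_Ioo fun τ hτ => ?_
      simp only [max_eq_right hτ.1.le, mul_comm]
    have l3 : ∫ k, p k * φ (xk k) ∂Measure.count = ∑' k, p k * φ (xk k) :=
      integral_nat_count _
    simp only [l1] at t1
    simp only [l2] at t2
    rw [l3] at t3
    have ht := (t2.add t1).add t3
    refine ht.congr' ?_
    filter_upwards [ioo_mem] with s hs
    have i1 := weak_integrable hs.2 hab.le hw1 hy1 ha1 hφ
    have i2 := weak_integrable hs.2 hab.le hg hy2 ha2 hφ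
    have i3 := weak_integrable hs.2 hab.le hw3 hy3 ha3 hφ
    have i21 := integral_add i2 i1
    have i213 := integral_add (i2.add i1) i3
    simp only [Pi.add_apply] at i213
    rw [← i21, ← i213, integral_Ioc_eq_integral_Ioo]
    refine setIntegral_congr_fun measurableSet_Ioo fun x hx => ?_
    rw [hH s x hx]
    ring
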